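/- Let N and M₁ be metric spaces, equip N × M₁ with the ℓ² product distance (WithLp 2 (N × M₁)), let γ₂ : ℝ → M₁ be a geodesic ray, fix x₀ ∈ N, and let γ : ℝ → N × M₁ be defined by γ s = (x₀, γ₂ s). Then for every real number c, the sublevel set {(x,y) ∈ N × M₁ : limsup_{s→∞} (s − dist_{ℓ²}((x,y), γ s)) ≤ c} equals Set.univ ×ˢ {y ∈ M₁ : limsup_{s→∞} (s − dist(y, γ₂ s)) ≤ c}, where limsup is taken along the filter atTop on ℝ. In particular, taking c = 0, the half-space H^γ determined by γ in the product equals N × H^{γ₂}. -/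

import Mathlib

open Filter

/-- The limit defining the Busemann function of a geodesic ray exists. -/
theorem exists_tendsto_sub_dist_of_ray {X : Type*} [PseudoMetricSpace X] {γ : ℝ → X}
    (hγ : ∀ s t : ℝ, 0 ≤ s → 0 ≤ t → dist (γ s) (γ t) = |s - t|) (y : X) :
    ∃ b : ℝ, Tendsto (fun s : ℝ => s - dist y (γ s)) atTop (nhds b) := by
  have hmono : Monotone fun s : ℝ => max s 0 - dist y (γ (max s 0)) := by
    intro s t hst
    have hst' : max s 0 ≤ max t 0 := max_le_max_right 0 hst
    have h := hγ (max s 0) (max t 0) (le_max_right _ _) (le_max_right _ _)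
    rw [abs_sub_comm, abs_of_nonneg (sub_nonneg.2 hst')] at h
    have := dist_triangle y (γ (max s 0)) (γ (max t 0))
    dsimp only
    linarith
  have hbdd : BddAbove (Set.range fun s : ℝ => max s 0 - dist y (γ (max s 0))) := by
    refine ⟨dist y (γ 0), ?_⟩
    rintro _ ⟨s, rfl⟩
    have hs : 0 ≤ max s 0 := le_max_right _ _
    have h := hγ 0 (max s 0) le_rfl hs
    rw [zero_sub, abs_neg, abs_of_nonneg hs] at h
    have := dist_triangle_left (γ 0) (γ (max s 0)) y
    dsimp only
    linarith
  refine ⟨_, (tendsto_atTop_ciSup hmono hbdd).congr' ?_⟩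
  filter_upwards [eventually_ge_atTop 0] with s hs
  rw [max_eq_left hs]

theorem tendsto_sqrt_sq_add_sq_sub_atTop (a : ℝ) :
    Tendsto (fun b : ℝ => √(a ^ 2 + b ^ 2) - b) atTop (nhds 0) := by
  refine tendsto_of_tendsto_of_tendsto_of_le_of_le' tendsto_const_nhds
    (tendsto_id.const_div_atTop (a ^ 2)) ?_ ?_
  · filter_upwards with b
    exact sub_nonneg.2 (Real.le_sqrt_of_sq_le (by nlinarith [sq_nonneg a]))
  · filter_upwards [eventually_gt_atTop 0] with b hb
    rw [sub_le_iff_le_add, id]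
    apply Real.sqrt_le_iff.2
    refine ⟨by positivity, ?_⟩
    have : (a ^ 2 / b + b) ^ 2 = (a ^ 2 / b) ^ 2 + 2 * a ^ 2 + b ^ 2 := by
      field_simp
      ring
    nlinarith [sq_nonneg (a ^ 2 / b), sq_nonneg a]

/-- The Busemann function of a ray in an `ℓ²` product which is constant in the first factor is the
Busemann function of its second component. -/
theorem limsup_sub_dist_toLp_ray {N M : Type*} [PseudoMetricSpace N] [PseudoMetricSpace M]
    {γ : ℝ → M} (hγ : ∀ s t : ℝ, 0 ≤ s → 0 ≤ t → dist (γ s) (γ t) = |s - t|)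
    (x₀ : N) (z : WithLp 2 (N × M)) :
    limsup (fun s : ℝ => s - dist z (WithLp.toLp 2 (x₀, γ s))) atTop =
      limsup (fun s : ℝ => s - dist z.snd (γ s)) atTop := by
  obtain ⟨b, hb⟩ := exists_tendsto_sub_dist_of_ray hγ z.snd
  have hdist : Tendsto (fun s : ℝ => dist z.snd (γ s)) atTop atTop := by
    simpa using tendsto_id.atTop_add hb.neg
  have hprod (s : ℝ) : dist z (WithLp.toLp 2 (x₀, γ s)) =
      √(dist z.fst x₀ ^ 2 + dist z.snd (γ s) ^ 2) := by
    rw [WithLp.prod_dist_eq_add (by norm_num), Real.sqrt_eq_rpow]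
    simp
  have h := hb.sub ((tendsto_sqrt_sq_add_sq_sub_atTop (dist z.fst x₀)).comp hdist)
  rw [sub_zero] at h
  rw [hb.limsup_eq]
  refine (h.congr fun s => ?_).limsup_eq
  rw [hprod, Function.comp_apply]
  ring

theorem halfspace_of_product_ray {N M₁ : Type*} [MetricSpace N] [MetricSpace M₁]
    (γ₂ : ℝ → M₁) (hγ₂ : ∀ s t : ℝ, 0 ≤ s → 0 ≤ t → dist (γ₂ s) (γ₂ t) = |s - t|)
    (x₀ : N) (γ : ℝ → WithLp 2 (N × M₁))
    (hγ : ∀ s : ℝ, γ s = (WithLp.equiv 2 (N × M₁)).symm (x₀, γ₂ s)) (c : ℝ) :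
    {z : WithLp 2 (N × M₁) | limsup (fun s : ℝ => s - dist z (γ s)) atTop ≤ c}
      = (WithLp.equiv 2 (N × M₁)) ⁻¹'
          (Set.univ ×ˢ {y : M₁ | limsup (fun s : ℝ => s - dist y (γ₂ s)) atTop ≤ c}) := by
  obtain rfl : γ = fun s => WithLp.toLp 2 (x₀, γ₂ s) := funext hγ
  ext z
  simp only [Set.mem_ofPred_eq, limsup_sub_dist_toLp_ray hγ₂, Set.mem_preimage, Set.mem_prod,
    Set.mem_univ, true_and]
  rfl
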